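/- Let G be a connected graph of order n. Then h_p(G) ≤ ⌊(n − Δ'(G) − d**_{≥3}(G))/3⌋ + 3. -/

import Mathlib

open SimpleGraph

namespace Paper

/-- A graph is traceable if it has a hamiltonian path. -/
def Traceable {α : Type*} (G : SimpleGraph α) : Prop :=
  ∃ (a b : α) (p : G.Walk a b), p.IsPath ∧ ∀ w, w ∈ p.support

/-- A graph is hamiltonian if it has a hamiltonian cycle. -/
def HamGraph {α : Type*} (G : SimpleGraph α) : Prop :=
  ∃ (a : α) (p : G.Walk a a), p.IsCycle ∧ ∀ w, w ∈ p.support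

/-- A graph together with its (varying) vertex type. -/
def GraphSys : Type 1 := Σ V : Type, SimpleGraph V

/-- One application of the line-graph operator. -/
def lineStep (p : GraphSys) : GraphSys := ⟨p.2.edgeSet, p.2.lineGraph⟩

/-- The `n`-th iterated line graph (with `L^0(G) = G`). -/
def iterLine (p : GraphSys) (n : ℕ) : GraphSys := lineStep^[n] p

/-- The hamiltonian path index: the least `n` with `L^n(G)` traceable. -/
noncomputable def hp {V : Type} (G : SimpleGraph V) : ℕ :=
  sInf {n | Traceable (iterLine ⟨V, G⟩ n).2}

/-- The hamiltonian index: the least `n` with `L^n(G)` hamiltonian. -/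
noncomputable def hIndex {V : Type} (G : SimpleGraph V) : ℕ :=
  sInf {n | HamGraph (iterLine ⟨V, G⟩ n).2}

/-- Degree of `v` in a subgraph `H` (number of neighbours). -/
noncomputable def sdeg {V : Type*} {G : SimpleGraph V} (H : G.Subgraph) (v : V) : ℕ :=
  (H.neighborSet v).ncard

/-- Degree of `v` in `G` (number of neighbours). -/
noncomputable def gdeg {V : Type*} (G : SimpleGraph V) (v : V) : ℕ :=
  (G.neighborSet v).ncard

/-- `Ē(H)`: the set of edges of `G` incident with a vertex of `H`. -/
def barE {V : Type*} (G : SimpleGraph V) (H : G.Subgraph) : Set (Sym2 V) :=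
  {e | e ∈ G.edgeSet ∧ ∃ v ∈ H.verts, v ∈ e}

/-- A circuit: a connected subgraph in which every vertex has even degree
(`K₁` counts as a circuit). -/
def IsCircuit {V : Type*} {G : SimpleGraph V} (H : G.Subgraph) : Prop :=
  H.Connected ∧ ∀ v, Even (sdeg H v)

/-- A branch of `G`: a nontrivial path whose ends have degree `≠ 2` and whose
internal vertices have degree `2`. -/
def IsBranch {V : Type*} (G : SimpleGraph V) {u v : V} (p : G.Walk u v) : Prop :=
  p.IsPath ∧ 0 < p.length ∧ gdeg G u ≠ 2 ∧ gdeg G v ≠ 2 ∧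
    ∀ w ∈ p.support, w ≠ u → w ≠ v → gdeg G w = 2

/-- The family `EUP_k(G)` of subgraphs satisfying (I'), (II), (III), (IV), (V'). -/
def EUP {V : Type*} (G : SimpleGraph V) (k : ℕ) : Set (G.Subgraph) :=
  {H | {v | Odd (sdeg H v)}.ncard ≤ 2 ∧
    (∀ v ∈ H.verts, H.neighborSet v = ∅ → 3 ≤ gdeg G v) ∧
    (∀ v, 3 ≤ gdeg G v → v ∈ H.verts) ∧
    (∀ H1 : G.Subgraph, H1 ≤ H → H1.verts.Nonempty → (H.verts \ H1.verts).Nonempty →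
      ∃ a ∈ H1.verts, ∃ b ∈ H.verts \ H1.verts, G.dist a b ≤ k - 1) ∧
    (∀ (u v : V) (p : G.Walk u v), IsBranch G p →
      (∀ e ∈ p.edges, e ∉ H.edgeSet) → p.length ≤ k + 1) ∧
    (∀ (u v : V) (p : G.Walk u v), IsBranch G p → (∃ w ∈ p.support, gdeg G w = 1) →
      (∀ e ∈ p.edges, e ∉ H.edgeSet) → p.length ≤ k)}

/-- The family `EU_k(G)` of subgraphs satisfying (I), (II), (III), (IV), (V). -/
def EU {V : Type*} (G : SimpleGraph V) (k : ℕ) : Set (G.Subgraph) :=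
  {H | (∀ v, Even (sdeg H v)) ∧
    (∀ v ∈ H.verts, H.neighborSet v = ∅ → 3 ≤ gdeg G v) ∧
    (∀ v, 3 ≤ gdeg G v → v ∈ H.verts) ∧
    (∀ H1 : G.Subgraph, H1 ≤ H → H1.verts.Nonempty → (H.verts \ H1.verts).Nonempty →
      ∃ a ∈ H1.verts, ∃ b ∈ H.verts \ H1.verts, G.dist a b ≤ k - 1) ∧
    (∀ (u v : V) (p : G.Walk u v), IsBranch G p →
      (∀ e ∈ p.edges, e ∉ H.edgeSet) → p.length ≤ k + 1) ∧
    (∀ (u v : V) (p : G.Walk u v), IsBranch G p → (∃ w ∈ p.support, gdeg G w = 1) →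
      p.length ≤ k)}

/-- `Δ'(G)`: the maximum number of distinct neighbours of a vertex. -/
noncomputable def deltaPrime {V : Type*} (G : SimpleGraph V) : ℕ :=
  sSup (Set.range (gdeg G))

/-- `d**₍≥3₎(G)`: the maximum over vertices `v` of maximum neighbour-count of the number of
vertices of degree `≥ 3` outside `N_G(v)`. -/
noncomputable def dStarStar {V : Type*} (G : SimpleGraph V) : ℕ :=
  sSup {m | ∃ v, gdeg G v = deltaPrime G ∧
    m = ({w | 3 ≤ gdeg G w} \ G.neighborSet v).ncard}


/-- Vertices of degree at least three. -/
def BB {V : Type*} (G : SimpleGraph V) : Set V := {w | 3 ≤ gdeg G w}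

/-- A nonempty list that is a path of `G`. -/
structure IsP {V : Type*} (G : SimpleGraph V) (T : List V) : Prop where
  chain : T.IsChain G.Adj
  nodup : T.Nodup
  ne : T ≠ []

/-- A path that cannot be left from a vertex of degree at most two. -/
def Sat {V : Type*} (G : SimpleGraph V) (T : List V) : Prop :=
  ∀ t ∈ T, ∀ z, G.Adj t z → z ∉ T → t ∈ BB G

theorem traceable_of_isP {V : Type*} {G : SimpleGraph V} {T : List V} (h : IsP G T)
    (hT : ∀ v, v ∈ T) : Traceable G := by
  refine ⟨_, _, Walk.ofSupport T h.ne h.chain, ?_, ?_⟩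
  · rw [Walk.isPath_def, Walk.support_ofSupport]; exact h.nodup
  · intro w; rw [Walk.support_ofSupport]; exact hT w

theorem exists_maximizer {α : Type*} (P : α → Prop) (f : α → ℕ) (N : ℕ)
    (h : ∀ a, P a → f a ≤ N) (hne : ∃ a, P a) : ∃ a, P a ∧ ∀ b, P b → f b ≤ f a := by
  classical
  obtain ⟨a0, h0⟩ := hne
  have hex : ∃ n, ∃ a, P a ∧ f a = n := ⟨_, a0, h0, rfl⟩
  have hs := Nat.findGreatest_spec (P := fun n => ∃ a, P a ∧ f a = n) (h a0 h0) ⟨a0, h0, rfl⟩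
  obtain ⟨a, ha, hfa⟩ := hs
  refine ⟨a, ha, fun b hb => ?_⟩
  rw [hfa]
  exact Nat.le_findGreatest (h b hb) ⟨b, hb, rfl⟩

theorem three_le_gdeg {V : Type*} [Finite V] {G : SimpleGraph V} {v a b c : V}
    (ha : G.Adj v a) (hb : G.Adj v b) (hc : G.Adj v c) (hab : a ≠ b) (hac : a ≠ c)
    (hbc : b ≠ c) : v ∈ BB G := by
  have h1 : ({a, b, c} : Set V) ⊆ G.neighborSet v := by
    intro x hx
    simp only [Set.mem_insert_iff, Set.mem_singleton_iff] at hx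
    rcases hx with rfl | rfl | rfl <;> simpa
  have h2 := Set.ncard_le_ncard h1 (Set.toFinite _)
  have h3 : ({a, b, c} : Set V).ncard = 3 := by
    rw [Set.ncard_eq_three]; exact ⟨a, b, c, hab, hac, hbc, rfl⟩
  show 3 ≤ (G.neighborSet v).ncard
  omega

theorem two_le_gdeg {V : Type*} [Finite V] {G : SimpleGraph V} {v a b : V}
    (ha : G.Adj v a) (hb : G.Adj v b) (hab : a ≠ b) : 2 ≤ gdeg G v := by
  have h1 : ({a, b} : Set V) ⊆ G.neighborSet v := by
    intro x hx
    simp only [Set.mem_insert_iff, Set.mem_singleton_iff] at hx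
    rcases hx with rfl | rfl <;> simpa
  have h2 := Set.ncard_le_ncard h1 (Set.toFinite _)
  rw [Set.ncard_pair hab] at h2
  exact h2

theorem sat_of_max {V : Type*} [Finite V] {G : SimpleGraph V} {T : List V} (hT : IsP G T)
    (h1 : ∀ z, ¬ IsP G (z :: T)) (h2 : ∀ z, ¬ IsP G (T ++ [z])) : Sat G T := by
  intro t ht z htz hz
  obtain ⟨l, r, rfl⟩ := List.append_of_mem ht
  have hc := hT.chain
  have hn := hT.nodup
  rcases List.eq_nil_or_concat l with rfl | ⟨l', a, rfl⟩
  · exact absurd ⟨by simpa using ⟨htz.symm, hc⟩, List.nodup_cons.2 ⟨by simpa using hz, hn⟩, by simp⟩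
      (h1 z)
  · rcases r with _ | ⟨b, r⟩
    · refine absurd ⟨?_, ?_, by simp⟩ (h2 z)
      · have : ((l'.concat a ++ [t]) ++ [z]) = (l'.concat a) ++ t :: z :: [] := by simp
        rw [this, List.isChain_append_cons_cons]
        exact ⟨hc, htz, by simp⟩
      · rw [List.nodup_append]
        refine ⟨hn, by simp, ?_⟩
        intro x hx y hy hxy
        simp only [List.mem_singleton] at hy
        subst hy; subst hxy; exact hz hx
    · have h3 : G.Adj a t ∧ G.Adj t b := by
        have e : l'.concat a ++ t :: b :: r = l' ++ a :: t :: b :: r := by simp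
        rw [e] at hc
        rw [List.isChain_append_cons_cons] at hc
        exact ⟨hc.2.1, hc.2.2.rel⟩
      have hz1 : z ≠ a := by rintro rfl; exact hz (by simp)
      have hz2 : z ≠ b := by rintro rfl; exact hz (by simp)
      have hab : a ≠ b := by
        rintro rfl
        simp [List.nodup_append] at hn
      exact three_le_gdeg h3.1.symm h3.2 htz hab hz1.symm hz2.symm

theorem exists_sat {V : Type*} [Finite V] {G : SimpleGraph V} {T : List V} (hT : IsP G T) :
    ∃ T', IsP G T' ∧ T ⊆ T' ∧ Sat G T' := by
  classical
  have := Fintype.ofFinite V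
  obtain ⟨T', ⟨h1, h2⟩, h3⟩ := exists_maximizer (fun S => IsP G S ∧ T ⊆ S) List.length
    (Fintype.card V) (fun a ha => ha.1.nodup.length_le_card) ⟨T, hT, fun _ h => h⟩
  refine ⟨T', h1, h2, sat_of_max h1 ?_ ?_⟩
  · intro z hz
    have := h3 _ ⟨hz, fun x hx => List.mem_cons_of_mem _ (h2 hx)⟩
    simp at this
  · intro z hz
    have := h3 _ ⟨hz, fun x hx => List.mem_append_left _ (h2 hx)⟩
    simp at this

theorem conn_closed {V : Type*} {G : SimpleGraph V} (hG : G.Connected) (S : Set V) {a : V}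
    (ha : a ∈ S) (h : ∀ x ∈ S, ∀ y, G.Adj x y → y ∈ S) (b : V) : b ∈ S := by
  obtain ⟨p⟩ := hG.preconnected a b
  induction p with
  | nil => exact ha
  | cons hadj p ih => exact ih (h _ ha _ hadj)

/-- A path which does not span has a vertex with a neighbour outside. -/
theorem exists_exit {V : Type*} {G : SimpleGraph V} (hG : G.Connected) (hnt : ¬ Traceable G)
    {T : List V} (hT : IsP G T) : ∃ t ∈ T, ∃ z, G.Adj t z ∧ z ∉ T := by
  by_contra hcon
  push Not at hcon
  obtain ⟨a, ha⟩ := List.exists_mem_of_ne_nil _ hT.ne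
  exact hnt (traceable_of_isP hT (conn_closed hG {x | x ∈ T} ha (fun x hx y hxy => hcon x hx y hxy)))

/-- Reachability of the high degree vertices by jumps of length at most `K`. -/
def CC {V : Type*} (G : SimpleGraph V) (T : List V) (K : ℕ) : Prop :=
  ∀ S : Set V, (∀ t ∈ T, t ∈ BB G → t ∈ S) →
    (∀ a ∈ BB G, a ∈ S → ∀ b ∈ BB G, ∀ p : G.Walk a b, p.length ≤ K → b ∈ S) →
    ∀ b ∈ BB G, b ∈ S

/-- Non-backtracking walks with `k` steps meet the path or a high degree vertex. -/
def DD {V : Type*} (G : SimpleGraph V) (T : List V) (k : ℕ) : Prop :=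
  ∀ x : ℕ → V, (∀ i, i < k → G.Adj (x i) (x (i + 1))) →
    (∀ i, i + 2 ≤ k → x i ≠ x (i + 2)) → ∃ i ≤ k, x i ∈ T ∨ x i ∈ BB G

/-- The invariant. -/
def QQ {V : Type*} (G : SimpleGraph V) (K : ℕ) : Prop :=
  G.Connected ∧ ∃ T, IsP G T ∧ Sat G T ∧ CC G T K ∧ DD G T (K + 1)


theorem sym2_eq_of_two {V : Type*} {u v : V} (h : u ≠ v) {e f : Sym2 V} (h1 : u ∈ e) (h2 : v ∈ e)
    (h3 : u ∈ f) (h4 : v ∈ f) : e = f := by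
  rw [(Sym2.mem_and_mem_iff h).1 ⟨h1, h2⟩, (Sym2.mem_and_mem_iff h).1 ⟨h3, h4⟩]

theorem lg_adj {V : Type*} {G : SimpleGraph V} {e f : G.edgeSet} (hne : e ≠ f) {v : V}
    (h1 : v ∈ (e : Sym2 V)) (h2 : v ∈ (f : Sym2 V)) : G.lineGraph.Adj e f :=
  lineGraph_adj_iff_exists.2 ⟨hne, v, h1, h2⟩

theorem ncard_inc {V : Type*} [Finite V] (G : SimpleGraph V) (v : V) :
    {e : G.edgeSet | v ∈ (e : Sym2 V)}.ncard = gdeg G v := by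
  have h : Subtype.val '' {e : G.edgeSet | v ∈ (e : Sym2 V)} = (fun w => s(v, w)) '' G.neighborSet v := by
    ext e
    constructor
    · rintro ⟨⟨e, he⟩, hv, rfl⟩
      obtain ⟨w, rfl⟩ := Sym2.mem_iff_exists.1 hv
      exact ⟨w, he, rfl⟩
    · rintro ⟨w, hw, rfl⟩
      exact ⟨⟨s(v, w), hw⟩, by simp, rfl⟩
  rw [← Set.ncard_image_of_injective _ Subtype.val_injective, h,
    Set.ncard_image_of_injective]
  · rfl
  · intro a b hab
    exact Sym2.congr_right.1 hab

theorem gdeg_line {V : Type*} [Finite V] (G : SimpleGraph V) {u v : V} (h : G.Adj u v) :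
    gdeg G.lineGraph ⟨s(u, v), h⟩ + 2 = gdeg G u + gdeg G v := by
  have h1 : G.lineGraph.neighborSet ⟨s(u, v), h⟩ =
      ({e : G.edgeSet | u ∈ (e : Sym2 V)} \ {⟨s(u, v), h⟩}) ∪
      ({e : G.edgeSet | v ∈ (e : Sym2 V)} \ {⟨s(u, v), h⟩}) := by
    ext f
    simp only [mem_neighborSet, lineGraph_adj_iff_exists, Set.mem_union, Set.mem_sdiff,
      Set.mem_ofPred_eq, Set.mem_singleton_iff, Sym2.mem_iff]
    constructor
    · rintro ⟨hne, w, rfl | rfl, hw⟩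
      · exact Or.inl ⟨hw, fun h => hne h.symm⟩
      · exact Or.inr ⟨hw, fun h => hne h.symm⟩
    · rintro (⟨hw, hne⟩ | ⟨hw, hne⟩)
      · exact ⟨fun h => hne h.symm, u, Or.inl rfl, hw⟩
      · exact ⟨fun h => hne h.symm, v, Or.inr rfl, hw⟩
  have hd : Disjoint ({e : G.edgeSet | u ∈ (e : Sym2 V)} \ {⟨s(u, v), h⟩})
      ({e : G.edgeSet | v ∈ (e : Sym2 V)} \ {⟨s(u, v), h⟩}) := by
    rw [Set.disjoint_left]
    rintro f ⟨hf1, hf2⟩ ⟨hf3, -⟩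
    exact hf2 (Subtype.ext (sym2_eq_of_two h.ne hf1 hf3 (by simp) (by simp)))
  have e1 := Set.ncard_sdiff_singleton_add_one (s := {e : G.edgeSet | u ∈ (e : Sym2 V)})
    (a := ⟨s(u, v), h⟩) (by simp) (Set.toFinite _)
  have e2 := Set.ncard_sdiff_singleton_add_one (s := {e : G.edgeSet | v ∈ (e : Sym2 V)})
    (a := ⟨s(u, v), h⟩) (by simp) (Set.toFinite _)
  rw [ncard_inc] at e1 e2
  have e3 : gdeg G.lineGraph ⟨s(u, v), h⟩ = _ := congrArg Set.ncard h1
  rw [Set.ncard_union_eq hd (Set.toFinite _) (Set.toFinite _)] at e3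
  omega

theorem line_connected {V : Type*} {G : SimpleGraph V} (hG : G.Connected) {u v : V}
    (h : G.Adj u v) : G.lineGraph.Connected := by
  have key : ∀ w, ∀ e : G.edgeSet, w ∈ (e : Sym2 V) → G.lineGraph.Reachable ⟨s(u, v), h⟩ e := by
    have adjr : ∀ (e f : G.edgeSet) (w : V), w ∈ (e : Sym2 V) → w ∈ (f : Sym2 V) →
        G.lineGraph.Reachable e f := by
      intro e f w h1 h2
      by_cases hef : e = f
      · subst hef; exact Reachable.refl _
      · exact (lg_adj hef h1 h2).reachable
    refine conn_closed hG {w | ∀ e : G.edgeSet, w ∈ (e : Sym2 V) →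
      G.lineGraph.Reachable ⟨s(u, v), h⟩ e} (a := u) ?_ ?_
    · intro e he
      exact adjr _ _ u (by simp) he
    · intro x hx y hxy e he
      exact (hx ⟨s(x, y), hxy⟩ (by simp)).trans (adjr _ _ y (by simp) he)
  have : Nonempty G.edgeSet := ⟨⟨s(u, v), h⟩⟩
  refine ⟨fun e f => ?_⟩
  obtain ⟨⟨e1, e2⟩, he⟩ := e
  obtain ⟨⟨f1, f2⟩, hf⟩ := f
  exact (key e1 _ (Sym2.mem_mk_left _ _)).symm.trans (key f1 _ (Sym2.mem_mk_left _ _))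

/-- The edges of a path form a path of the line graph. -/
theorem line_path {V : Type*} {G : SimpleGraph V} (l : List V) : ∀ (a b : V) (hab : G.Adj a b),
    IsP G (a :: b :: l) → ∃ T : List G.edgeSet, IsP G.lineGraph (⟨s(a, b), hab⟩ :: T) ∧
      (∀ t ∈ a :: b :: l, ∃ f ∈ (⟨s(a, b), hab⟩ :: T : List G.edgeSet), t ∈ (f : Sym2 V)) ∧
      (∀ f ∈ T, a ∉ (f : Sym2 V)) ∧
      (∀ f ∈ (⟨s(a, b), hab⟩ :: T : List G.edgeSet), ∀ x ∈ (f : Sym2 V), x ∈ a :: b :: l) := by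
  induction l with
  | nil =>
    intro a b hab h
    refine ⟨[], ⟨by simp, by simp, by simp⟩, by simp, by simp, by simp⟩
  | cons c l ih =>
    intro a b hab h
    have hc := h.chain
    have hn := h.nodup
    have hbc : G.Adj b c := hc.of_cons.rel
    obtain ⟨T, hT, hcov, hna, hin⟩ := ih b c hbc ⟨hc.of_cons, hn.of_cons, by simp⟩
    have han : a ∉ b :: c :: l := (List.nodup_cons.1 hn).1
    have hA : ∀ f ∈ (⟨s(b, c), hbc⟩ :: T : List G.edgeSet), a ∉ (f : Sym2 V) :=
      fun f hf haf => han (hin f hf a haf)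
    refine ⟨⟨s(b, c), hbc⟩ :: T, ⟨?_, ?_, by simp⟩, ?_, hA, ?_⟩
    · rw [List.isChain_cons_cons]
      refine ⟨lg_adj (v := b) ?_ (by simp) (by simp), hT.chain⟩
      intro heq
      exact hA _ List.mem_cons_self (by rw [← heq]; simp)
    · rw [List.nodup_cons]
      exact ⟨fun hm => hA _ hm (by simp), hT.nodup⟩
    · intro t ht
      rw [List.mem_cons] at ht
      rcases ht with rfl | ht
      · exact ⟨_, List.mem_cons_self, by simp⟩
      · obtain ⟨f, hf, htf⟩ := hcov t ht
        exact ⟨f, List.mem_cons_of_mem _ hf, htf⟩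
    · intro f hf x hx
      rw [List.mem_cons] at hf
      rcases hf with rfl | hf
      · simp only [Sym2.mem_iff] at hx
        rcases hx with rfl | rfl <;> simp
      · exact List.mem_cons_of_mem _ (hin f hf x hx)

theorem line_path' {V : Type*} {G : SimpleGraph V} (hG : G.Connected) (hnt : ¬ Traceable G)
    {T : List V} (hT : IsP G T) : ∃ T', IsP G.lineGraph T' ∧
      ∀ t ∈ T, ∃ f ∈ T', t ∈ (f : Sym2 V) := by
  rcases T with _ | ⟨a, _ | ⟨b, l⟩⟩
  · exact absurd rfl hT.ne
  · obtain ⟨t, ht, z, hz, -⟩ := exists_exit hG hnt hT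
    simp only [List.mem_singleton] at ht
    subst ht
    exact ⟨[⟨s(t, z), hz⟩], ⟨by simp, by simp, by simp⟩, by simp⟩
  · obtain ⟨T', h1, h2, -⟩ := line_path l a b hT.chain.rel hT
    exact ⟨_, h1, h2⟩


theorem line_walk {V : Type*} {G : SimpleGraph V} {a b : V} (p : G.Walk a b) :
    ∀ (x : V) (hx : G.Adj x a), ∃ (y : V) (hy : G.Adj y b)
      (q : G.lineGraph.Walk ⟨s(x, a), hx⟩ ⟨s(y, b), hy⟩), q.length ≤ p.length ∧
        (y = x ∨ y ∈ p.support) ∧ (0 < p.length → y = p.penultimate) ∧ (p.length = 0 → y = x) := by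
  induction p with
  | nil => intro x hx; exact ⟨x, hx, Walk.nil, by simp⟩
  | @cons a c b hac p ih =>
    intro x hx
    obtain ⟨y, hy, q, hq, hy1, hy2, hy3⟩ := ih a hac
    have hpen : y = (Walk.cons hac p).penultimate := by
      rcases Nat.eq_zero_or_pos p.length with h0 | h0
      · rw [hy3 h0]
        cases p with
        | nil => rfl
        | cons _ _ => simp at h0
      · rw [hy2 h0]
        cases p with
        | nil => simp at h0
        | cons _ _ => rfl
    have hy1' : y = x ∨ y ∈ (Walk.cons hac p).support := by
      right
      rcases hy1 with h | h <;> simp [h]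
    by_cases hne : (⟨s(x, a), hx⟩ : G.edgeSet) = ⟨s(a, c), hac⟩
    · rw [hne]
      exact ⟨y, hy, q, by simp; omega, hy1', fun _ => hpen, by simp⟩
    · exact ⟨y, hy, Walk.cons (lg_adj hne (v := a) (by simp) (by simp)) q, by simp; omega, hy1',
        fun _ => hpen, by simp⟩

theorem two_le_snd {V : Type*} [Finite V] {G : SimpleGraph V} {a b : V} {p : G.Walk a b}
    (hp : p.IsPath) (hb : b ∈ BB G) (hl : 0 < p.length) : 2 ≤ gdeg G p.snd := by
  cases p with
  | nil => simp at hl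
  | cons h q =>
    cases q with
    | nil =>
      have : 3 ≤ gdeg G b := hb
      simpa using by omega
    | cons h' r =>
      simp only [Walk.snd_cons]
      refine two_le_gdeg h.symm h' ?_
      rintro rfl
      simp [Walk.cons_isPath_iff] at hp

theorem mem_BB_line {V : Type*} [Finite V] {G : SimpleGraph V} {u v : V} (h : G.Adj u v) :
    (⟨s(u, v), h⟩ : G.edgeSet) ∈ BB G.lineGraph ↔ 5 ≤ gdeg G u + gdeg G v := by
  have := gdeg_line G h
  show 3 ≤ _ ↔ _
  omega

theorem exists_BB_of_line {V : Type*} [Finite V] {G : SimpleGraph V} {e : G.edgeSet}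
    (h : e ∈ BB G.lineGraph) : ∃ y ∈ BB G, y ∈ (e : Sym2 V) := by
  obtain ⟨⟨u, v⟩, he⟩ := e
  have h5 : 5 ≤ gdeg G u + gdeg G v := (mem_BB_line (G := G) he).1 h
  rcases Nat.lt_or_ge (gdeg G u) 3 with h3 | h3
  · exact ⟨v, show 3 ≤ gdeg G v by omega, Sym2.mem_mk_right _ _⟩
  · exact ⟨u, h3, Sym2.mem_mk_left _ _⟩

theorem CC_step {V : Type*} [Finite V] {G : SimpleGraph V} {T : List V} {K : ℕ} (hK : 1 ≤ K)
    (hC : CC G T (K + 1)) {T' : List G.edgeSet} (hS' : Sat G.lineGraph T')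
    (hcov : ∀ t ∈ T, ∃ f ∈ T', t ∈ (f : Sym2 V)) : CC G.lineGraph T' K := by
  intro S' hS1 hS2
  have hadj : ∀ e ∈ BB G.lineGraph, e ∈ S' → ∀ f ∈ BB G.lineGraph, ∀ v, v ∈ (e : Sym2 V) →
      v ∈ (f : Sym2 V) → f ∈ S' := by
    intro e he heS f hf v hve hvf
    by_cases hef : e = f
    · exact hef ▸ heS
    · exact hS2 e he heS f hf (lg_adj hef hve hvf).toWalk (by simpa using hK)
  have main := hC {y | ∀ e ∈ BB G.lineGraph, y ∈ (e : Sym2 V) → e ∈ S'} ?_ ?_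
  · intro e he
    obtain ⟨y, hy, hye⟩ := exists_BB_of_line he
    exact main y hy e he hye
  · intro t ht htB e he hte
    obtain ⟨f, hf, htf⟩ := hcov t ht
    by_cases hfB : f ∈ BB G.lineGraph
    · exact hadj f hfB (hS1 f hf hfB) e he t htf hte
    · by_cases heT : e ∈ T'
      · exact hS1 e heT he
      · exact absurd (hS' f hf e (lg_adj (fun h => heT (h ▸ hf)) htf hte) heT) hfB
  · intro a haB haS b hbB p hp
    classical
    by_cases hab : a = b
    · exact hab ▸ haS
    have hlen := p.length_bypass_le_length
    have hpath := p.bypass_isPath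
    generalize p.bypass = q at hlen hpath
    intro e he hbe
    have hq0 : 0 < q.length := by
      rcases Nat.eq_zero_or_pos q.length with h | h
      · exact absurd (Walk.eq_of_length_eq_zero h) hab
      · exact h
    have d1 := two_le_snd hpath hbB hq0
    have d2 := two_le_snd hpath.reverse haB (by simpa using hq0)
    rw [Walk.snd_reverse] at d2
    have ha3 : 3 ≤ gdeg G a := haB
    have hb3 : 3 ≤ gdeg G b := hbB
    cases q with
    | nil => simp at hq0
    | @cons _ c _ hac r =>
      obtain ⟨y, hy, w, hw, -, hy2, hy3⟩ := line_walk r a hac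
      have hyd : 2 ≤ gdeg G y := by
        cases r with
        | nil => rw [hy3 rfl]; omega
        | cons _ _ =>
          rw [hy2 (by simp)]
          exact d2
      simp only [Walk.snd_cons] at d1
      have m1 : (⟨s(a, c), hac⟩ : G.edgeSet) ∈ BB G.lineGraph := (mem_BB_line hac).2 (by omega)
      have m2 : (⟨s(y, b), hy⟩ : G.edgeSet) ∈ BB G.lineGraph := (mem_BB_line hy).2 (by omega)
      have s1 := haS _ m1 (by simp)
      have s2 := hS2 _ m1 s1 _ m2 w (by simp at hlen; omega)
      exact hadj _ m2 s2 e he b (by simp) hbe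


/-- A triangle of low degree vertices is everything. -/
theorem triangle_all {V : Type*} [Finite V] {G : SimpleGraph V} (hG : G.Connected) {a b c : V}
    (hab : G.Adj a b) (hac : G.Adj a c) (hbc : G.Adj b c) (ha : a ∉ BB G) (hb : b ∉ BB G)
    (hc : c ∉ BB G) (x : V) : x = a ∨ x = b ∨ x = c := by
  refine conn_closed hG {x | x = a ∨ x = b ∨ x = c} (a := a) (Or.inl rfl) ?_ x
  rintro x hx y hxy
  by_contra hy
  simp only [Set.mem_ofPred_eq, not_or] at hy
  obtain ⟨h1, h2, h3⟩ := hy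
  rcases hx with rfl | rfl | rfl
  · exact ha (three_le_gdeg hab hac hxy hbc.ne (Ne.symm h2) (Ne.symm h3))
  · exact hb (three_le_gdeg hab.symm hbc hxy hac.ne (Ne.symm h1) (Ne.symm h3))
  · exact hc (three_le_gdeg hac.symm hbc.symm hxy hab.ne (Ne.symm h1) (Ne.symm h2))

theorem DD_step {V : Type*} [Finite V] {G : SimpleGraph V} {T : List V} {k : ℕ} (hk : 2 ≤ k)
    (hLG : G.lineGraph.Connected) (hS : Sat G T) (hD : DD G T (k + 1))
    {T' : List G.edgeSet} (hP' : IsP G.lineGraph T')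
    (hcov : ∀ t ∈ T, ∃ f ∈ T', t ∈ (f : Sym2 V)) : DD G.lineGraph T' k := by
  intro e hadj hnb
  by_contra hcon
  push Not at hcon
  have hw : ∀ i, ∃ w, i < k → w ∈ (e i : Sym2 V) ∧ w ∈ (e (i + 1) : Sym2 V) := by
    intro i
    by_cases hi : i < k
    · obtain ⟨-, w, h⟩ := lineGraph_adj_iff_exists.1 (hadj i hi)
      exact ⟨w, fun _ => h⟩
    · obtain ⟨⟨a, _⟩, _⟩ := e 0
      exact ⟨a, fun h => absurd h hi⟩
  choose w hw using hw
  have hwne : ∀ i, i + 1 < k → w i ≠ w (i + 1) := by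
    intro i hi heq
    have h1 := hw i (by omega)
    have h2 := hw (i + 1) hi
    rw [← heq] at h2
    have hall := triangle_all hLG (hadj i (by omega))
      (lg_adj (hnb i (by omega)) h1.1 h2.2) (hadj (i + 1) hi) (hcon i (by omega)).2
      (hcon (i + 1) (by omega)).2 (hcon (i + 2) (by omega)).2
    obtain ⟨f, hf⟩ := List.exists_mem_of_ne_nil _ hP'.ne
    rcases hall f with rfl | rfl | rfl
    · exact (hcon i (by omega)).1 hf
    · exact (hcon (i + 1) (by omega)).1 hf
    · exact (hcon (i + 2) (by omega)).1 hf
  obtain ⟨m, rfl⟩ : ∃ m, k = m + 2 := ⟨k - 2, by omega⟩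
  obtain ⟨x0, hx0⟩ := Sym2.mem_iff_exists.1 (hw 0 (by omega)).1
  obtain ⟨x1, hx1⟩ := Sym2.mem_iff_exists.1 (hw (m + 1) (by omega)).2
  obtain ⟨x, hxz, hxm, hxl⟩ : ∃ x : ℕ → V, x 0 = x0 ∧ (∀ i, i < m + 2 → x (i + 1) = w i) ∧
      x (m + 3) = x1 := by
    refine ⟨fun i => if i = 0 then x0 else if i = m + 3 then x1 else w (i - 1), by simp, ?_,
      by simp⟩
    intro i hi
    have : i ≠ m + 2 := by omega
    simp [this]
  have hex : ∀ i, i < m + 3 → (e i : Sym2 V) = s(x i, x (i + 1)) := by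
    intro i hi
    rcases i with _ | i
    · rw [hxz, hxm 0 (by omega), hx0, Sym2.eq_swap]
    · by_cases hi2 : i + 1 < m + 2
      · rw [hxm i (by omega), hxm (i + 1) hi2]
        exact (Sym2.mem_and_mem_iff (hwne i hi2)).1 ⟨(hw i (by omega)).2, (hw (i + 1) hi2).1⟩
      · obtain rfl : i = m + 1 := by omega
        rw [hxl, hxm (m + 1) (by omega), hx1]
  have hxadj : ∀ i, i < m + 3 → G.Adj (x i) (x (i + 1)) := by
    intro i hi
    have := (e i).2
    rw [hex i hi] at this
    exact this
  have hxnb : ∀ i, i + 2 ≤ m + 3 → x i ≠ x (i + 2) := by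
    intro i hi heq
    refine (hadj i (by omega)).ne (Subtype.ext ?_)
    rw [hex i (by omega), hex (i + 1) (by omega), ← heq, Sym2.eq_swap]
  have hsum : ∀ i, i < m + 3 → gdeg G (x i) + gdeg G (x (i + 1)) ≤ 4 := by
    intro i hi
    have h1 := (hcon i (by omega)).2
    have h2 : e i = ⟨s(x i, x (i + 1)), hxadj i hi⟩ := Subtype.ext (hex i hi)
    rw [h2, mem_BB_line] at h1
    omega
  have hint : ∀ i, i + 2 ≤ m + 3 → 2 ≤ gdeg G (x (i + 1)) := by
    intro i hi
    exact two_le_gdeg (hxadj i (by omega)).symm (hxadj (i + 1) (by omega)) (hxnb i hi)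
  have hdeg : ∀ i, i ≤ m + 3 → gdeg G (x i) ≤ 2 := by
    intro i hi
    rcases Nat.lt_or_ge i (m + 2) with h | h
    · have := hint i (by omega); have := hsum i (by omega); omega
    · obtain ⟨j, rfl⟩ : ∃ j, i = j + 2 := ⟨i - 2, by omega⟩
      have := hint j (by omega)
      have : gdeg G (x (j + 1)) + gdeg G (x (j + 2)) ≤ 4 := hsum (j + 1) (by omega)
      omega
  have hnB : ∀ i, i ≤ m + 3 → x i ∉ BB G := by
    intro i hi hB
    have : 3 ≤ gdeg G (x i) := hB
    have := hdeg i hi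
    omega
  have hnT : ∀ i, i + 2 ≤ m + 3 → x (i + 1) ∉ T := by
    intro i hi hT
    obtain ⟨f, hf, hxf⟩ := hcov _ hT
    obtain ⟨y, hy⟩ := Sym2.mem_iff_exists.1 hxf
    have hady : G.Adj (x (i + 1)) y := by
      have := f.2; rw [hy] at this; exact this
    by_cases h1 : y = x i
    · refine (hcon i (by omega)).1 ?_
      have : e i = f := Subtype.ext (by rw [hex i (by omega), hy, h1, Sym2.eq_swap])
      rw [this]; exact hf
    · by_cases h2 : y = x (i + 2)
      · refine (hcon (i + 1) (by omega)).1 ?_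
        have : e (i + 1) = f := Subtype.ext (by rw [hex (i + 1) (by omega), hy, h2])
        rw [this]; exact hf
      · exact hnB (i + 1) (by omega) (three_le_gdeg (hxadj i (by omega)).symm
          (hxadj (i + 1) (by omega)) hady (hxnb i hi) (Ne.symm h1) (Ne.symm h2))
  obtain ⟨i, hi, h | h⟩ := hD x hxadj hxnb
  · rcases i with _ | i
    · exact hnB 0 (by omega) (hS _ h _ (hxadj 0 (by omega)) (hnT 0 (by omega)))
    · by_cases hi2 : i + 2 ≤ m + 3
      · exact hnT i hi2 h
      · obtain rfl : i = m + 2 := by omega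
        exact hnB (m + 3) (by omega)
          (hS _ h _ (hxadj (m + 2) (by omega)).symm (hnT (m + 1) (by omega)))
  · exact hnB i hi h

theorem QQ_step {V : Type*} [Finite V] {G : SimpleGraph V} {K : ℕ} (hK : 1 ≤ K)
    (hnt : ¬ Traceable G) (hQ : QQ G (K + 1)) : QQ G.lineGraph K := by
  obtain ⟨hG, T, hP, hS, hC, hD⟩ := hQ
  obtain ⟨t, -, z, htz, -⟩ := exists_exit hG hnt hP
  have hLG := line_connected hG htz
  obtain ⟨T0, hP0, hcov0⟩ := line_path' hG hnt hP
  obtain ⟨T', hP', hsub, hS'⟩ := exists_sat hP0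
  have hcov : ∀ t ∈ T, ∃ f ∈ T', t ∈ (f : Sym2 V) := by
    intro t ht
    obtain ⟨f, hf, h⟩ := hcov0 t ht
    exact ⟨f, hsub hf, h⟩
  exact ⟨hLG, T', hP', hS', CC_step hK hC hS' hcov, DD_step (by omega) hLG hS hD hP' hcov⟩


theorem chain_of_common {V : Type*} {G : SimpleGraph V} {v : V} (l : List G.edgeSet)
    (hn : l.Nodup) (h : ∀ e ∈ l, v ∈ (e : Sym2 V)) : l.IsChain G.lineGraph.Adj := by
  induction l with
  | nil => simp
  | cons a l ih =>
    rw [List.isChain_cons]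
    refine ⟨?_, ih hn.of_cons (fun e he => h e (List.mem_cons_of_mem _ he))⟩
    intro y hy
    have hy' : y ∈ l := List.mem_of_mem_head? hy
    refine lg_adj ?_ (h a List.mem_cons_self) (h y (List.mem_cons_of_mem _ hy'))
    rintro rfl
    exact (List.nodup_cons.1 hn).1 hy'

theorem hnw_list {V : Type*} [Finite V] {G : SimpleGraph V} {a b : V} (W : G.Walk a b) :
    ∀ F : Set G.edgeSet, W.IsTrail → (∀ e ∈ F, (e : Sym2 V) ∉ W.edges) →
      (∀ e ∈ F, ∃ v ∈ W.support, v ∈ (e : Sym2 V)) →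
      ∃ l : List G.edgeSet, l.Nodup ∧ l.IsChain G.lineGraph.Adj ∧
        (∀ e, e ∈ l ↔ e ∈ F ∨ (e : Sym2 V) ∈ W.edges) ∧
        (∀ e ∈ l.head?, a ∈ (e : Sym2 V)) := by
  classical
  induction W with
  | @nil a =>
    intro F _ _ hF
    have hFa : ∀ e ∈ F, a ∈ (e : Sym2 V) := by
      intro e he
      obtain ⟨v, hv, hve⟩ := hF e he
      simp only [Walk.support_nil, List.mem_singleton] at hv
      exact hv ▸ hve
    have hfin := Set.toFinite F
    refine ⟨hfin.toFinset.toList, Finset.nodup_toList _, ?_, by simp, ?_⟩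
    · exact chain_of_common (v := a) _ (Finset.nodup_toList _) (by simpa using hFa)
    · intro e he
      have := List.mem_of_mem_head? he
      exact hFa e (by simpa using this)
  | @cons a c b hac W ih =>
    intro F ht hd hF
    rw [Walk.isTrail_cons] at ht
    obtain ⟨l, hn, hch, hmem, hhead⟩ := ih {e ∈ F | a ∉ (e : Sym2 V)} ht.1
      (fun e he h => hd e he.1 (by simp [h])) (by
        intro e he
        obtain ⟨v, hv, hve⟩ := hF e he.1
        simp only [Walk.support_cons, List.mem_cons] at hv
        rcases hv with rfl | hv
        · exact absurd hve he.2
        · exact ⟨v, hv, hve⟩)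
    let Fa : Set G.edgeSet := {e ∈ F | a ∈ (e : Sym2 V)}
    have hfin : Fa.Finite := Set.toFinite _
    let e0 : G.edgeSet := ⟨s(a, c), hac⟩
    have hL : (hfin.toFinset.toList ++ [e0]).Nodup := by
      rw [List.nodup_append]
      refine ⟨Finset.nodup_toList _, by simp, ?_⟩
      rintro x hx y hy rfl
      simp only [List.mem_singleton] at hy
      simp only [Finset.mem_toList, Set.Finite.mem_toFinset] at hx
      exact hd x hx.1 (by simp [hy, e0])
    have hLa : ∀ e ∈ hfin.toFinset.toList ++ [e0], a ∈ (e : Sym2 V) := by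
      intro e he
      rw [List.mem_append] at he
      rcases he with he | he
      · simp only [Finset.mem_toList, Set.Finite.mem_toFinset] at he
        exact he.2
      · simp only [List.mem_singleton] at he
        rw [he]; simp [e0]
    have he0l : e0 ∉ l := by
      rw [hmem]
      rintro (h | h)
      · exact h.2 (by simp [e0])
      · exact ht.2 h
    refine ⟨(hfin.toFinset.toList ++ [e0]) ++ l, ?_, ?_, ?_, ?_⟩
    · rw [List.nodup_append]
      refine ⟨hL, hn, ?_⟩
      rintro x hx y hy rfl
      rw [List.mem_append] at hx
      rcases hx with hx | hx
      · simp only [Finset.mem_toList, Set.Finite.mem_toFinset] at hx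
        rcases (hmem x).1 hy with h | h
        · exact h.2 hx.2
        · exact hd x hx.1 (by simp [h])
      · simp only [List.mem_singleton] at hx
        exact he0l (hx ▸ hy)
    · rw [List.isChain_append]
      refine ⟨chain_of_common (v := a) _ hL hLa, hch, ?_⟩
      intro x hx y hy
      simp only [List.getLast?_append, List.getLast?_singleton, Option.some_or,
        Option.mem_def, Option.some.injEq] at hx
      subst hx
      refine lg_adj (v := c) ?_ (by simp [e0]) (hhead y hy)
      rintro rfl
      exact he0l (List.mem_of_mem_head? hy)
    · intro e
      rw [List.mem_append, List.mem_append, hmem]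
      simp only [Finset.mem_toList, Set.Finite.mem_toFinset,
        Walk.edges_cons, List.mem_cons]
      have : e = e0 ↔ (e : Sym2 V) = s(a, c) := Subtype.ext_iff
      rw [this]
      show ((e ∈ F ∧ a ∈ (e : Sym2 V)) ∨ _) ∨ (e ∈ F ∧ a ∉ (e : Sym2 V)) ∨ _ ↔ _
      tauto
    · intro e he
      apply hLa
      rw [List.head?_append] at he
      rcases h : (hfin.toFinset.toList ++ [e0]).head? with _ | z
      · simp at h
      · rw [h] at he
        simp only [Option.some_or, Option.mem_def, Option.some.injEq] at he
        subst he
        exact List.mem_of_mem_head? h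

theorem hnw {V : Type*} [Finite V] {G : SimpleGraph V} {a b : V} (W : G.Walk a b)
    (hW : W.IsTrail) (hne : Nonempty G.edgeSet)
    (hdom : ∀ e : G.edgeSet, ∃ v ∈ W.support, v ∈ (e : Sym2 V)) : Traceable G.lineGraph := by
  obtain ⟨l, hn, hch, hmem, -⟩ := hnw_list W {e | (e : Sym2 V) ∉ W.edges} hW
    (fun e he => he) (fun e _ => hdom e)
  have hall : ∀ e, e ∈ l := fun e => (hmem e).2 (by
    by_cases h : (e : Sym2 V) ∈ W.edges
    · exact Or.inr h
    · exact Or.inl h)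
  obtain ⟨e⟩ := hne
  exact traceable_of_isP ⟨hch, hn, List.ne_nil_of_mem (hall e)⟩ hall


theorem walk_of_chain {V : Type*} {G : SimpleGraph V} (l : List V) :
    ∀ (a b : V), (a :: (l ++ [b])).IsChain G.Adj →
      ∃ W : G.Walk a b, W.support = a :: (l ++ [b]) := by
  induction l with
  | nil =>
    intro a b h
    exact ⟨Walk.cons h.rel Walk.nil, by simp⟩
  | cons c l ih =>
    intro a b h
    obtain ⟨W, hW⟩ := ih c b h.of_cons
    exact ⟨Walk.cons h.rel W, by simp [hW]⟩

/-- Trails of the line graph made of edges with centre in `Z`, full at each `z ∈ Z`. -/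
structure Tr {V : Type*} (G : SimpleGraph V) (Z : Set V) {e f : G.edgeSet}
    (W : G.lineGraph.Walk e f) : Prop where
  trail : W.IsTrail
  centre : ∀ a b, s(a, b) ∈ W.edges → ∃ z ∈ Z, z ∈ (a : Sym2 V) ∧ z ∈ (b : Sym2 V)
  full : ∀ z ∈ Z, ∀ g : G.edgeSet, z ∈ (g : Sym2 V) → g ∈ W.support

theorem ham_path {V : Type*} [Finite V] {G : SimpleGraph V} {v : V} {g g' : G.edgeSet}
    (hne : g ≠ g') (hg : v ∈ (g : Sym2 V)) (hg' : v ∈ (g' : Sym2 V)) :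
    ∃ W : G.lineGraph.Walk g g', W.IsPath ∧ ∀ e, e ∈ W.support ↔ v ∈ (e : Sym2 V) := by
  classical
  have hfin : {e : G.edgeSet | v ∈ (e : Sym2 V) ∧ e ≠ g ∧ e ≠ g'}.Finite := Set.toFinite _
  let m := hfin.toFinset.toList
  have hm : ∀ e, e ∈ m ↔ v ∈ (e : Sym2 V) ∧ e ≠ g ∧ e ≠ g' := by
    intro e; simp [m]
  have hl : ∀ e, e ∈ g :: (m ++ [g']) ↔ v ∈ (e : Sym2 V) := by
    intro e
    simp only [List.mem_cons, List.mem_append, hm, List.not_mem_nil, or_false]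
    constructor
    · rintro (rfl | h | rfl)
      · exact hg
      · exact h.1
      · exact hg'
    · intro h; tauto
  have hn : (g :: (m ++ [g'])).Nodup := by
    rw [List.nodup_cons, List.nodup_append]
    refine ⟨?_, Finset.nodup_toList _, by simp, ?_⟩
    · simp [hm, hne]
    · rintro x hx y hy rfl
      simp only [List.mem_singleton] at hy
      exact ((hm x).1 hx).2.2 hy
  have hc := chain_of_common (v := v) _ hn (fun e he => (hl e).1 he)
  obtain ⟨W, hWs⟩ := walk_of_chain _ _ _ hc
  refine ⟨W, ?_, ?_⟩
  · rw [Walk.isPath_def, hWs]; exact hn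
  · intro e
    rw [hWs]; exact hl e

theorem ham_cycle {V : Type*} [Finite V] {G : SimpleGraph V} {v : V} (hv : v ∈ BB G)
    {g : G.edgeSet} (hg : v ∈ (g : Sym2 V)) :
    ∃ W : G.lineGraph.Walk g g, W.IsTrail ∧ ∀ e, e ∈ W.support ↔ v ∈ (e : Sym2 V) := by
  have h3 : 3 ≤ {e : G.edgeSet | v ∈ (e : Sym2 V)}.ncard := by rw [ncard_inc]; exact hv
  obtain ⟨g', hg', hne⟩ : ∃ g' ∈ {e : G.edgeSet | v ∈ (e : Sym2 V)}, g' ≠ g :=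
    Set.exists_ne_of_one_lt_ncard (by omega) g
  obtain ⟨h, hh, hhn⟩ : ∃ h ∈ {e : G.edgeSet | v ∈ (e : Sym2 V)}, h ∉ ({g, g'} : Set G.edgeSet) := by
    apply Set.exists_mem_notMem_of_ncard_lt_ncard
    · rw [Set.ncard_pair (Ne.symm hne)]; omega
    · exact Set.toFinite _
  obtain ⟨P, hP, hs⟩ := ham_path (Ne.symm hne) hg hg'
  refine ⟨Walk.cons (lg_adj (Ne.symm hne) hg hg') P.reverse, ?_, ?_⟩
  · rw [Walk.isTrail_cons]
    refine ⟨hP.isTrail.reverse, ?_⟩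
    rw [Walk.edges_reverse, List.mem_reverse]
    intro hmem
    have hhP : h ∈ P.support := (hs h).2 hh
    cases P with
    | nil => exact hne rfl
    | cons hadj q =>
      rw [Walk.cons_isPath_iff] at hP
      simp only [Walk.edges_cons, List.mem_cons] at hmem
      rcases hmem with hmem | hmem
      · have := Sym2.congr_right.1 hmem
        subst this
        obtain rfl := Walk.isPath_iff_eq_nil.1 hP.1
        simp at hhP
        exact hhn (by simpa using hhP)
      · exact hP.2 (Walk.fst_mem_support_of_mem_edges _ hmem)
  · intro e
    simp only [Walk.support_cons, List.mem_cons, Walk.support_reverse, List.mem_reverse, hs]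
    constructor
    · rintro (rfl | h)
      · exact hg
      · exact h
    · exact Or.inr

theorem centre_unique {V : Type*} {G : SimpleGraph V} {a b : G.edgeSet} (hab : a ≠ b) {v z : V}
    (h1 : v ∈ (a : Sym2 V)) (h2 : v ∈ (b : Sym2 V)) (h3 : z ∈ (a : Sym2 V))
    (h4 : z ∈ (b : Sym2 V)) : v = z := by
  by_contra h
  exact hab (Subtype.ext (sym2_eq_of_two h h1 h3 h2 h4))

theorem edges_disj {V : Type*} {G : SimpleGraph V} {Z : Set V} {e f : G.edgeSet}
    {W : G.lineGraph.Walk e f} (hW : Tr G Z W) {v : V} (hv : v ∉ Z) {g h : G.edgeSet}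
    {C : G.lineGraph.Walk g h} (hC : ∀ e ∈ C.support, v ∈ (e : Sym2 V)) :
    ∀ x ∈ W.edges, x ∉ C.edges := by
  intro x
  induction x with
  | _ a b =>
  intro hx hxC
  obtain ⟨z, hz, hza, hzb⟩ := hW.centre a b hx
  have h1 := hC a (Walk.fst_mem_support_of_mem_edges _ hxC)
  have h2 := hC b (Walk.snd_mem_support_of_mem_edges _ hxC)
  have := centre_unique (W.adj_of_mem_edges hx).ne h1 h2 hza hzb
  exact hv (this ▸ hz)

theorem absorb {V : Type*} [Finite V] {G : SimpleGraph V} {Z : Set V} {e f : G.edgeSet}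
    {W : G.lineGraph.Walk e f} (hW : Tr G Z W) {v : V} (hv : v ∉ Z) (hvB : v ∈ BB G)
    {g : G.edgeSet} (hg : g ∈ W.support) (hvg : v ∈ (g : Sym2 V)) :
    ∃ W' : G.lineGraph.Walk e f, Tr G (insert v Z) W' ∧ W.support ⊆ W'.support := by
  classical
  obtain ⟨C, hC, hCs⟩ := ham_cycle hvB hvg
  have hdis := edges_disj hW hv (C := C) (fun e he => (hCs e).1 he)
  have hspec := W.take_spec hg
  have hed : W.edges = (W.takeUntil g hg).edges ++ (W.dropUntil g hg).edges := by
    rw [← Walk.edges_append, hspec]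
  have hsup : ∀ x, x ∈ W.support ↔
      x ∈ (W.takeUntil g hg).support ∨ x ∈ (W.dropUntil g hg).support := by
    intro x
    rw [← Walk.mem_support_append_iff, hspec]
  have hmem : ∀ x, x ∈ ((W.takeUntil g hg).append (C.append (W.dropUntil g hg))).edges ↔
      x ∈ W.edges ∨ x ∈ C.edges := by
    intro x
    rw [hed]
    simp only [Walk.edges_append, List.mem_append]
    tauto
  have hsup' : ∀ x, x ∈ ((W.takeUntil g hg).append (C.append (W.dropUntil g hg))).support ↔
      x ∈ W.support ∨ x ∈ C.support := by
    intro x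
    rw [hsup]
    simp only [Walk.mem_support_append_iff]
    tauto
  refine ⟨(W.takeUntil g hg).append (C.append (W.dropUntil g hg)), ⟨?_, ?_, ?_⟩, ?_⟩
  · have ht := hW.trail
    rw [Walk.isTrail_def] at ht hC ⊢
    have hperm : ((W.takeUntil g hg).append (C.append (W.dropUntil g hg))).edges.Perm
        (W.edges ++ C.edges) := by
      rw [hed, Walk.edges_append, Walk.edges_append, List.append_assoc]
      exact List.Perm.append_left _ List.perm_append_comm
    rw [hperm.nodup_iff, List.nodup_append]
    exact ⟨ht, hC, fun x hx y hy hxy => hdis x hx (hxy ▸ hy)⟩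
  · intro a b hab
    rcases (hmem _).1 hab with h | h
    · obtain ⟨z, hz, h⟩ := hW.centre a b h
      exact ⟨z, Or.inr hz, h⟩
    · exact ⟨v, Or.inl rfl, (hCs a).1 (Walk.fst_mem_support_of_mem_edges _ h),
        (hCs b).1 (Walk.snd_mem_support_of_mem_edges _ h)⟩
  · rintro z (rfl | hz) x hx
    · exact (hsup' x).2 (Or.inr ((hCs x).2 hx))
    · exact (hsup' x).2 (Or.inl (hW.full z hz x hx))
  · intro x hx
    exact (hsup' x).2 (Or.inl hx)

theorem prepend {V : Type*} [Finite V] {G : SimpleGraph V} {Z : Set V} {e f : G.edgeSet}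
    {W : G.lineGraph.Walk e f} (hW : Tr G Z W) {v : V} (hv : v ∉ Z)
    {g : G.edgeSet} (hge : g ≠ e) (hvg : v ∈ (g : Sym2 V)) (hve : v ∈ (e : Sym2 V)) :
    ∃ W' : G.lineGraph.Walk g f, Tr G (insert v Z) W' ∧ W.support ⊆ W'.support := by
  obtain ⟨C, hC, hCs⟩ := ham_path hge hvg hve
  have hdis := edges_disj hW hv (C := C) (fun e he => (hCs e).1 he)
  refine ⟨C.append W, ⟨?_, ?_, ?_⟩, ?_⟩
  · have ht := hW.trail
    have hC' := hC.isTrail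
    rw [Walk.isTrail_def] at ht hC' ⊢
    rw [Walk.edges_append, List.nodup_append]
    exact ⟨hC', ht, fun x hx y hy hxy => hdis y hy (hxy ▸ hx)⟩
  · intro a b hab
    rw [Walk.edges_append, List.mem_append] at hab
    rcases hab with h | h
    · exact ⟨v, Or.inl rfl, (hCs a).1 (Walk.fst_mem_support_of_mem_edges _ h),
        (hCs b).1 (Walk.snd_mem_support_of_mem_edges _ h)⟩
    · obtain ⟨z, hz, h⟩ := hW.centre a b h
      exact ⟨z, Or.inr hz, h⟩
  · rintro z (rfl | hz) x hx
    · exact Walk.mem_support_append_iff _ _ |>.2 (Or.inl ((hCs x).2 hx))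
    · exact Walk.mem_support_append_iff _ _ |>.2 (Or.inr (hW.full z hz x hx))
  · intro x hx
    exact Walk.mem_support_append_iff _ _ |>.2 (Or.inr hx)

theorem base_trail {V : Type*} [Finite V] {G : SimpleGraph V} (l : List V) :
    ∀ (a b : V) (hab : G.Adj a b), IsP G (a :: b :: l) →
      ∃ (Z : Set V) (f : G.edgeSet) (W : G.lineGraph.Walk ⟨s(a, b), hab⟩ f), Tr G Z W ∧
        (∀ z ∈ Z, z ∈ b :: l) ∧ (b ∈ Z → l ≠ []) ∧
        (∀ z ∈ Z, z ≠ b → z ∈ l) ∧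
        ∀ t ∈ a :: b :: l, ∃ g ∈ W.support, t ∈ (g : Sym2 V) := by
  induction l with
  | nil =>
    intro a b hab h
    refine ⟨∅, _, Walk.nil, ⟨by simp, by simp, by simp⟩, by simp, by simp, by simp, ?_⟩
    simp
  | cons c l ih =>
    intro a b hab h
    have hc := h.chain
    have hn := h.nodup
    have hbc : G.Adj b c := hc.of_cons.rel
    obtain ⟨Z, f, W, hW, hZ, -, -, hcov⟩ := ih b c hbc ⟨hc.of_cons, hn.of_cons, by simp⟩
    have hbZ : b ∉ Z := fun hb => (List.nodup_cons.1 hn.of_cons).1 (hZ b hb)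
    have hne : (⟨s(a, b), hab⟩ : G.edgeSet) ≠ ⟨s(b, c), hbc⟩ := by
      intro heq
      have h1 : a ∈ s(b, c) := by
        have h2 : s(a, b) = s(b, c) := Subtype.ext_iff.1 heq
        rw [← h2]; simp
      simp only [Sym2.mem_iff] at h1
      rcases h1 with rfl | rfl <;> simp at hn
    obtain ⟨W', hW', hsub⟩ := prepend hW hbZ hne (v := b) (by simp) (by simp)
    refine ⟨insert b Z, f, W', hW', ?_, by simp, ?_, ?_⟩
    · rintro z (rfl | hz)
      · simp
      · exact List.mem_cons_of_mem _ (hZ z hz)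
    · rintro z (rfl | hz) hzb
      · exact absurd rfl hzb
      · exact hZ z hz
    · intro t ht
      rw [List.mem_cons] at ht
      rcases ht with rfl | ht
      · exact ⟨_, W'.start_mem_support, by simp⟩
      · obtain ⟨g, hg, htg⟩ := hcov t ht
        exact ⟨g, hsub hg, htg⟩


/-- A covering trail in the line graph. -/
def Cov {V : Type*} (G : SimpleGraph V) (T : List V) (Z : Set V) : Prop :=
  ∃ (e f : G.edgeSet) (W : G.lineGraph.Walk e f), Tr G Z W ∧
    ∀ t ∈ T, ∃ g ∈ W.support, t ∈ (g : Sym2 V)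

theorem cov_base {V : Type*} [Finite V] {G : SimpleGraph V} (hG : G.Connected)
    (hnt : ¬ Traceable G) {T : List V} (hT : IsP G T) : ∃ Z, Cov G T Z := by
  rcases T with _ | ⟨a, _ | ⟨b, l⟩⟩
  · exact absurd rfl hT.ne
  · obtain ⟨t, ht, z, hz, -⟩ := exists_exit hG hnt hT
    simp only [List.mem_singleton] at ht
    subst ht
    refine ⟨∅, ⟨s(t, z), hz⟩, ⟨s(t, z), hz⟩, Walk.nil, ⟨by simp, by simp, by simp⟩, by simp⟩
  · have hab : G.Adj a b := hT.chain.rel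
    obtain ⟨Z, f, W, h1, -, -, -, h2⟩ := base_trail l a b hab hT
    exact ⟨Z, _, f, W, h1, h2⟩

theorem QQ_final {V : Type*} [Finite V] {G : SimpleGraph V} (hnt : ¬ Traceable G)
    (hQ : QQ G 1) : Traceable G.lineGraph.lineGraph := by
  obtain ⟨hG, T, hP, hS, hC, hD⟩ := hQ
  obtain ⟨Z, ⟨e, f, W, hW, hcov⟩, hmax⟩ := exists_maximizer (fun Z => Cov G T Z) Set.ncard
    (Nat.card V) (fun Z _ => Set.ncard_le_card Z) (cov_base hG hnt hP)
  have habs : ∀ v ∈ BB G, ∀ g ∈ W.support, v ∈ (g : Sym2 V) → v ∈ Z := by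
    intro v hv g hg hvg
    by_contra hvZ
    obtain ⟨W', hW', hsub⟩ := absorb hW hvZ hv hg hvg
    have := hmax (insert v Z) ⟨e, f, W', hW', fun t ht => by
      obtain ⟨g, hg, h⟩ := hcov t ht
      exact ⟨g, hsub hg, h⟩⟩
    rw [Set.ncard_insert_of_notMem hvZ (Set.toFinite _)] at this
    omega
  have hB : ∀ b ∈ BB G, b ∈ Z := by
    refine hC Z ?_ ?_
    · intro t ht htB
      obtain ⟨g, hg, h⟩ := hcov t ht
      exact habs t htB g hg h
    · intro a _ haZ b hbB p hp
      cases p with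
      | nil => exact haZ
      | cons h q =>
        cases q with
        | nil =>
          exact habs b hbB ⟨s(a, b), h⟩ (hW.full a haZ _ (Sym2.mem_mk_left _ _)) (Sym2.mem_mk_right _ _)
        | cons h' q' => simp at hp
  obtain ⟨t, ht, z, htz, hzT⟩ := exists_exit hG hnt hP
  have htB := hS t ht z htz hzT
  have hne : Nonempty G.lineGraph.edgeSet := by
    have h3 : 3 ≤ {e : G.edgeSet | t ∈ (e : Sym2 V)}.ncard := by rw [ncard_inc]; exact htB
    obtain ⟨g', hg', hne⟩ : ∃ g' ∈ {e : G.edgeSet | t ∈ (e : Sym2 V)}, g' ≠ ⟨s(t, z), htz⟩ :=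
      Set.exists_ne_of_one_lt_ncard (by omega) _
    exact ⟨⟨s(g', ⟨s(t, z), htz⟩), lg_adj hne hg' (Sym2.mem_mk_left _ _)⟩⟩
  refine hnw W hW.trail hne ?_
  rintro ⟨ef, hef⟩
  induction ef with
  | _ e1 e2 =>
  obtain ⟨hn12, w, hw1, hw2⟩ := lineGraph_adj_iff_exists.1 hef
  by_cases hwB : w ∈ BB G
  · exact ⟨e1, hW.full w (hB w hwB) _ hw1, Sym2.mem_mk_left _ _⟩
  obtain ⟨e1, he1⟩ := e1
  obtain ⟨e2, he2⟩ := e2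
  obtain ⟨u1, rfl⟩ := Sym2.mem_iff_exists.1 hw1
  obtain ⟨u2, rfl⟩ := Sym2.mem_iff_exists.1 hw2
  have hu : u1 ≠ u2 := by rintro rfl; exact hn12 rfl
  have ha1 : G.Adj w u1 := he1
  have ha2 : G.Adj w u2 := he2
  by_cases hwT : w ∈ T
  · obtain ⟨⟨g, hgE⟩, hg, hwg⟩ := hcov w hwT
    obtain ⟨u3, rfl⟩ := Sym2.mem_iff_exists.1 hwg
    by_cases h1 : u3 = u1
    · subst h1; exact ⟨_, hg, Sym2.mem_mk_left _ _⟩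
    by_cases h2 : u3 = u2
    · subst h2; exact ⟨_, hg, Sym2.mem_mk_right _ _⟩
    exact absurd (three_le_gdeg ha1 ha2 hgE hu (Ne.symm h1) (Ne.symm h2)) hwB
  · obtain ⟨i, hi, hx⟩ := hD (fun i => if i = 0 then u1 else if i = 1 then w else u2)
      (by
        intro i hi
        have : i = 0 ∨ i = 1 := by omega
        rcases this with rfl | rfl
        · simpa using ha1.symm
        · simpa using ha2)
      (by
        intro i hi
        have : i = 0 := by omega
        subst this
        simpa using hu)
    have key : ∀ u, G.Adj w u → (u ∈ T ∨ u ∈ BB G) → u ∈ BB G := by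
      intro u hwu h
      rcases h with h | h
      · exact hS u h w hwu.symm hwT
      · exact h
    have hi3 : i = 0 ∨ i = 1 ∨ i = 2 := by omega
    rcases hi3 with rfl | rfl | rfl
    · exact ⟨_, hW.full u1 (hB u1 (key u1 ha1 (by simpa using hx))) ⟨s(w, u1), he1⟩
        (Sym2.mem_mk_right _ _), Sym2.mem_mk_left _ _⟩
    · simp [hwT, hwB] at hx
    · exact ⟨_, hW.full u2 (hB u2 (key u2 ha2 (by simpa using hx))) ⟨s(w, u2), he2⟩
        (Sym2.mem_mk_right _ _), Sym2.mem_mk_right _ _⟩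

theorem iter_main (K : ℕ) : ∀ (V : Type) [Finite V] (G : SimpleGraph V), QQ G (K + 1) →
    ∃ i ≤ K + 2, Traceable (iterLine ⟨V, G⟩ i).2 := by
  induction K with
  | zero =>
    intro V _ G hQ
    by_cases hnt : Traceable G
    · exact ⟨0, by omega, hnt⟩
    · exact ⟨2, by omega, QQ_final hnt hQ⟩
  | succ K ih =>
    intro V _ G hQ
    by_cases hnt : Traceable G
    · exact ⟨0, by omega, hnt⟩
    · obtain ⟨i, hi, h⟩ := ih G.edgeSet G.lineGraph (QQ_step (by omega) hnt hQ)
      refine ⟨i + 1, by omega, ?_⟩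
      exact h


open Classical in
/-- Number of entries of the list that lie in `D`. -/
noncomputable def wt {V : Type*} (D : Set V) (l : List V) : ℕ := l.countP (fun x => decide (x ∈ D))

theorem wt_append {V : Type*} (D : Set V) (l l' : List V) : wt D (l ++ l') = wt D l + wt D l' := by
  simp [wt]

theorem wt_cons {V : Type*} (D : Set V) (a : V) (l : List V) : wt D (a :: l) = wt D [a] + wt D l :=
  wt_append D [a] l

theorem wt_reverse {V : Type*} (D : Set V) (l : List V) : wt D l.reverse = wt D l := by
  simp [wt]

theorem wt_le_length {V : Type*} (D : Set V) (l : List V) : wt D l ≤ l.length := by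
  unfold wt; exact List.countP_le_length

theorem wt_eq_length {V : Type*} (D : Set V) (l : List V) (h : ∀ x ∈ l, x ∈ D) :
    wt D l = l.length := by
  unfold wt; rw [List.countP_eq_length]; simpa using h

theorem wt_mono {V : Type*} (D : Set V) {l l' : List V} (hn : l.Nodup) (h : l ⊆ l') :
    wt D l ≤ wt D l' := by
  classical
  unfold wt
  exact (List.subperm_of_subset hn h).countP_le _

theorem wt_le_ncard {V : Type*} [Finite V] (D : Set V) {l : List V} (hn : l.Nodup) :
    wt D l ≤ D.ncard := by
  classical
  have h1 : wt D l = (l.filter (fun x => decide (x ∈ D))).length := by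
    unfold wt; rw [List.countP_eq_length_filter]
  rw [h1, ← List.toFinset_card_of_nodup (hn.filter _), ← Set.ncard_coe_finset]
  apply Set.ncard_le_ncard _ (Set.toFinite _)
  intro x hx
  simp at hx
  exact hx.2

theorem branch {V : Type*} [Finite V] {G : SimpleGraph V} {D : Set V} {T : List V} (hT : IsP G T)
    (hmax : ∀ T', IsP G T' → wt D T' ≤ wt D T) {t : V} (ht : t ∈ T) {R : List V}
    (hc : (t :: R).IsChain G.Adj) (hn : R.Nodup) (hR : ∀ r ∈ R, r ∉ T) :
    3 * wt D R ≤ D.ncard := by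
  obtain ⟨T1, T2, rfl⟩ := List.append_of_mem ht
  have hTn := hT.nodup
  have hTc := hT.chain
  have htR : t ∉ R := fun h => hR t h ht
  have h1 : wt D (T1 ++ t :: R) ≤ wt D (T1 ++ t :: T2) := by
    apply hmax
    refine ⟨?_, ?_, by simp⟩
    · rw [List.isChain_split] at hTc ⊢
      exact ⟨hTc.1, hc⟩
    · rw [List.nodup_append] at hTn ⊢
      refine ⟨hTn.1, List.nodup_cons.2 ⟨htR, hn⟩, ?_⟩
      intro a ha b hb
      rcases List.mem_cons.1 hb with rfl | hb
      · exact hTn.2.2 a ha _ (by simp)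
      · rintro rfl
        exact hR a hb (by simp [ha])
  have h2 : wt D (T2.reverse ++ t :: R) ≤ wt D (T1 ++ t :: T2) := by
    apply hmax
    refine ⟨?_, ?_, by simp⟩
    · rw [List.isChain_split] at hTc ⊢
      refine ⟨?_, hc⟩
      have := List.isChain_reverse.2 hTc.2
      simp only [List.reverse_cons] at this
      exact this.imp (fun _ _ h => h.symm)
    · rw [List.nodup_append] at hTn ⊢
      have h3 := List.nodup_cons.1 hTn.2.1
      refine ⟨List.nodup_reverse.2 h3.2, List.nodup_cons.2 ⟨htR, hn⟩, ?_⟩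
      intro a ha b hb
      have ha' : a ∈ T2 := List.mem_reverse.1 ha
      rcases List.mem_cons.1 hb with rfl | hb
      · rintro rfl; exact h3.1 ha'
      · rintro rfl
        exact hR a hb (by simp [ha'])
  have h3 : wt D (T1 ++ (t :: T2) ++ R) ≤ D.ncard := by
    apply wt_le_ncard
    rw [List.nodup_append]
    refine ⟨hTn, hn, ?_⟩
    rintro a ha b hb rfl
    exact hR a hb ha
  rw [wt_append, wt_append, wt_cons] at h1 h2
  rw [wt_append, wt_append] at h3
  rw [wt_cons D t T2] at h1 h2 h3
  rw [wt_reverse] at h2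
  omega

theorem connector {V : Type*} {G : SimpleGraph V} (hG : G.Connected) {A X : Set V}
    (hA : A.Nonempty) (hX : X.Nonempty) (hdis : ∀ a ∈ A, a ∉ X) :
    ∃ (a x : V) (R : List V), a ∈ A ∧ x ∈ X ∧ (a :: (R ++ [x])).IsChain G.Adj ∧
      (a :: (R ++ [x])).Nodup ∧ ∀ r ∈ R, r ∉ A ∧ r ∉ X := by
  classical
  let P : ℕ → Prop := fun n => ∃ (a x : V) (R : List V), R.length = n ∧ a ∈ A ∧ x ∈ X ∧
    (a :: (R ++ [x])).IsChain G.Adj ∧ (a :: (R ++ [x])).Nodup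
  have hex : ∃ n, P n := by
    obtain ⟨a, ha⟩ := hA
    obtain ⟨x, hx⟩ := hX
    obtain ⟨p, hp⟩ := (hG.preconnected a x).exists_isPath
    cases p with
    | nil => exact absurd hx (hdis _ ha)
    | cons h q =>
      have hs : (Walk.cons h q).support = a :: (q.support.dropLast ++ [x]) := by
        rw [Walk.support_cons]
        congr 1
        conv_lhs => rw [← List.dropLast_append_getLast q.support_ne_nil]
        simp
      refine ⟨_, a, x, q.support.dropLast, rfl, ha, hx, ?_, ?_⟩
      · rw [← hs]; exact Walk.isChain_adj_support _
      · rw [← hs]; exact hp.support_nodup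
  obtain ⟨a, x, R, hl, ha, hx, hc, hn⟩ := Nat.find_spec hex
  refine ⟨a, x, R, ha, hx, hc, hn, ?_⟩
  intro r hr
  obtain ⟨R1, R2, rfl⟩ := List.append_of_mem hr
  have hlen : ∀ m, m < (R1 ++ r :: R2).length → ¬ P m := by
    intro m hm
    rw [hl] at hm
    exact Nat.find_min hex hm
  constructor
  · intro hrA
    refine hlen R2.length (by simp; omega) ⟨r, x, R2, rfl, hrA, hx, ?_, ?_⟩
    · have e : a :: (R1 ++ r :: R2 ++ [x]) = (a :: R1) ++ (r :: (R2 ++ [x])) := by simp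
      rw [e] at hc
      exact (List.isChain_append.1 hc).2.1
    · have e : a :: (R1 ++ r :: R2 ++ [x]) = (a :: R1) ++ (r :: (R2 ++ [x])) := by simp
      rw [e] at hn
      exact (List.nodup_append.1 hn).2.1
  · intro hrX
    have e : a :: (R1 ++ r :: R2 ++ [x]) = (a :: (R1 ++ [r])) ++ (R2 ++ [x]) := by simp
    refine hlen R1.length (by simp) ⟨a, r, R1, rfl, ha, hrX, ?_, ?_⟩
    · rw [e] at hc
      exact (List.isChain_append.1 hc).1
    · rw [e] at hn
      exact (List.nodup_append.1 hn).1


theorem interior_nonadj {V : Type*} [Finite V] {G : SimpleGraph V} {p b v : V} {q : List V}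
    (hc : (p :: (q ++ [b])).IsChain G.Adj) (hn : (p :: (q ++ [b])).Nodup)
    (hv : v ∉ p :: (q ++ [b])) (hq : ∀ c ∈ q, c ∉ BB G) : ∀ c ∈ q, ¬ G.Adj v c := by
  intro c hcq hvc
  refine hq c hcq ?_
  obtain ⟨l1, l2, rfl⟩ := List.append_of_mem hcq
  obtain ⟨l1', p', h1⟩ : ∃ l1' p', p :: l1 = l1' ++ [p'] :=
    ⟨_, _, (List.dropLast_append_getLast (l := p :: l1) (by simp)).symm⟩
  obtain ⟨s, l2', h2⟩ : ∃ s l2', l2 ++ [b] = s :: l2' := List.exists_cons_of_ne_nil (by simp)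
  have e : p :: (l1 ++ c :: l2 ++ [b]) = l1' ++ p' :: c :: s :: l2' := by
    calc p :: (l1 ++ c :: l2 ++ [b]) = (p :: l1) ++ c :: (l2 ++ [b]) := by simp
      _ = _ := by rw [h1, h2]; simp
  rw [e] at hc hn hv
  have hc' := (List.isChain_append.1 hc).2.1
  have hn' := (List.nodup_append.1 hn).2.1
  have a1 : G.Adj p' c := hc'.rel
  have a2 : G.Adj c s := hc'.of_cons.rel
  simp at hv hn'
  refine three_le_gdeg a1.symm a2 hvc.symm ?_ ?_ ?_
  · exact hn'.1.2.1
  · exact fun h => hv.2.1 h.symm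
  · exact fun h => hv.2.2.2.1 h.symm

theorem wt_between {V : Type*} [Finite V] {G : SimpleGraph V} {a b v : V} {q : List V}
    (hc : (a :: (q ++ [b])).IsChain G.Adj) (hn : (a :: (q ++ [b])).Nodup)
    (hv : v ∈ BB G) (hq : ∀ c ∈ q, c ∉ BB G) :
    q.length ≤ wt {w | w ∉ BB G ∧ ¬ G.Adj v w} q + 1 := by
  have hvq : ∀ c ∈ q, v ≠ c := by rintro c hc rfl; exact hq _ hc hv
  by_cases hvb : v = b
  · rcases List.eq_nil_or_concat q with rfl | ⟨q', c, rfl⟩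
    · simp
    have hva : v ≠ a := by
      rintro rfl
      subst hvb
      simp at hn
    rw [List.concat_eq_append] at *
    have hc' : (a :: (q' ++ [c])).IsChain G.Adj :=
      (List.isChain_append.1 (show ((a :: (q' ++ [c])) ++ [b]).IsChain G.Adj from hc)).1
    have hn' : (a :: (q' ++ [c])).Nodup :=
      (List.nodup_append.1 (show ((a :: (q' ++ [c])) ++ [b]).Nodup from hn)).1
    have h := interior_nonadj (v := v) hc' hn' (by
      intro h
      rcases List.mem_cons.1 h with h | h
      · exact hva h
      · exact hvq _ h rfl) (fun d hd => hq d (by simp [hd]))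
    rw [wt_append, wt_eq_length {w | w ∉ BB G ∧ ¬ G.Adj v w} q' (fun d hd => ⟨hq d (by simp [hd]), h d hd⟩)]
    simp
  · rcases q with _ | ⟨c, q'⟩
    · simp
    have hc' : (c :: (q' ++ [b])).IsChain G.Adj := List.IsChain.of_cons (by simpa using hc)
    have hn' : (c :: (q' ++ [b])).Nodup := List.Nodup.of_cons (by simpa using hn)
    have h := interior_nonadj (v := v) hc' hn' (by
      intro h
      have h' : v ∈ (c :: q') ++ [b] := by simpa using h
      rcases List.mem_append.1 h' with h | h
      · exact hvq _ h rfl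
      · exact hvb (by simpa using h)) (fun d hd => hq d (by simp [hd]))
    rw [wt_cons, wt_eq_length {w | w ∉ BB G ∧ ¬ G.Adj v w} q' (fun d hd => ⟨hq d (by simp [hd]), h d hd⟩)]
    simp

theorem split_list {V : Type*} (B S : Set V) (l : List V) : ∀ (a : V) (q : List V),
    a ∈ B → a ∈ S → (∀ c ∈ q, c ∉ B) → (∃ y ∈ l, y ∈ B ∧ y ∉ S) →
    ∃ (L : List V) (a' : V) (q' : List V) (b : V) (M : List V),
      a :: (q ++ l) = L ++ a' :: (q' ++ b :: M) ∧ a' ∈ B ∧ a' ∈ S ∧ b ∈ B ∧ b ∉ S ∧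
      ∀ c ∈ q', c ∉ B := by
  induction l with
  | nil => intro a q _ _ _ h; simp at h
  | cons c l ih =>
    intro a q haB haS hq hy
    by_cases hcB : c ∈ B
    · by_cases hcS : c ∈ S
      · obtain ⟨y, hy, hyB, hyS⟩ := hy
        have hyl : y ∈ l := by
          rcases List.mem_cons.1 hy with rfl | h
          · exact absurd hcS hyS
          · exact h
        obtain ⟨L, a', q', b, M, e, h⟩ := ih c [] hcB hcS (by simp) ⟨y, hyl, hyB, hyS⟩
        refine ⟨a :: q ++ L, a', q', b, M, ?_, h⟩
        simp only [List.nil_append] at e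
        rw [e]; simp
      · exact ⟨[], a, q, c, l, by simp, haB, haS, hcB, hcS, hq⟩
    · obtain ⟨y, hy, hyB, hyS⟩ := hy
      have hyl : y ∈ l := by
        rcases List.mem_cons.1 hy with rfl | h
        · exact absurd hyB hcB
        · exact h
      obtain ⟨L, a', q', b, M, e, h⟩ := ih a (q ++ [c]) haB haS (by
        intro d hd
        rcases List.mem_append.1 hd with hd | hd
        · exact hq d hd
        · simp at hd; subst hd; exact hcB) ⟨y, hyl, hyB, hyS⟩
      exact ⟨L, a', q', b, M, by rw [← e]; simp, h⟩

theorem init_CC {V : Type*} [Finite V] {G : SimpleGraph V} (hG : G.Connected) {v : V}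
    (hv : v ∈ BB G) {T : List V} (hT : IsP G T) (hS : Sat G T)
    (hmax : ∀ T', IsP G T' → wt {w | w ∉ BB G ∧ ¬ G.Adj v w} T' ≤ wt {w | w ∉ BB G ∧ ¬ G.Adj v w} T) :
    CC G T ({w | w ∉ BB G ∧ ¬ G.Adj v w}.ncard / 3 + 2) := by
  intro S h1 h2 y hy
  by_contra hyS
  have hyT : y ∉ T := fun h => hyS (h1 y h hy)
  obtain ⟨t, y', R, ht, rfl, hc, hn, hR⟩ := connector hG (A := {x | x ∈ T}) (X := {y})
    (List.exists_mem_of_ne_nil _ hT.ne) ⟨y, rfl⟩ (by rintro a ha rfl; exact hyT ha)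
  have hoff : ∀ r ∈ R ++ [y'], r ∉ T := by
    intro r hr
    rcases List.mem_append.1 hr with hr | hr
    · exact (hR r hr).1
    · simp at hr; subst hr; exact hyT
  have htB : t ∈ BB G := by
    obtain ⟨z, l, e⟩ : ∃ z l, R ++ [y'] = z :: l := List.exists_cons_of_ne_nil (by simp)
    rw [e] at hc hoff
    exact hS t ht z hc.rel (hoff z (by simp))
  have hbr := branch hT hmax ht hc hn.of_cons hoff
  obtain ⟨L, a, q, b, M, e, haB, haS, hbB, hbS, hq⟩ :=
    split_list (BB G) S (R ++ [y']) t [] htB (h1 t ht htB) (by simp) ⟨y', by simp, hy, hyS⟩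
  rw [List.nil_append] at e
  have e' : L ++ a :: (q ++ b :: M) = L ++ (a :: (q ++ [b]) ++ M) := by simp
  rw [e, e'] at hc hn
  have hc' := (List.isChain_append.1 (List.isChain_append.1 hc).2.1).1
  have hn' := (List.nodup_append.1 (List.nodup_append.1 hn).2.1).1
  have hb := wt_between hc' hn' hv hq
  obtain ⟨W, hW⟩ := walk_of_chain q a b hc'
  have hlen : W.length = q.length + 1 := by
    have := W.length_support
    rw [hW] at this
    simp at this
    omega
  have hlt : ¬ W.length ≤ {w | w ∉ BB G ∧ ¬ G.Adj v w}.ncard / 3 + 2 :=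
    fun h => hbS (h2 a haB haS b hbB W h)
  have hle : wt {w | w ∉ BB G ∧ ¬ G.Adj v w} q ≤ wt {w | w ∉ BB G ∧ ¬ G.Adj v w} (R ++ [y']) := by
    rcases L with _ | ⟨c, L⟩
    · simp only [List.nil_append, List.cons.injEq] at e
      rw [e.2, wt_append]; omega
    · simp only [List.cons_append, List.cons.injEq] at e
      rw [e.2, wt_append, wt_cons, wt_append]; omega
  omega


theorem dd_core {V : Type*} [Finite V] {G : SimpleGraph V} {v : V}
    (hv : v ∈ BB G) {T : List V} (hT : IsP G T)
    (hmax : ∀ T', IsP G T' → wt {w | w ∉ BB G ∧ ¬ G.Adj v w} T' ≤ wt {w | w ∉ BB G ∧ ¬ G.Adj v w} T)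
    {K : ℕ} (hK : {w | w ∉ BB G ∧ ¬ G.Adj v w}.ncard / 3 + 2 = K)
    (x : ℕ → V) (hadj : ∀ i, i < K + 1 → G.Adj (x i) (x (i + 1)))
    (hnb : ∀ i, i + 2 ≤ K + 1 → x i ≠ x (i + 2))
    (hoff : ∀ i ≤ K + 1, x i ∉ T ∧ x i ∉ BB G)
    {t : V} {R : List V} (ht : t ∈ T) (hc : (t :: (R ++ [x 0])).IsChain G.Adj)
    (hn : (t :: (R ++ [x 0])).Nodup) (hR : ∀ r ∈ R, r ∉ T ∧ ∀ i ≤ K + 1, r ≠ x i) : False := by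
  obtain ⟨L, z, hz⟩ : ∃ L z, t :: R = L ++ [z] :=
    ⟨_, _, (List.dropLast_append_getLast (l := t :: R) (by simp)).symm⟩
  have hzm : z ∈ t :: R := by rw [hz]; simp
  have hzX : ∀ i ≤ K + 1, z ≠ x i := by
    intro i hi
    rcases List.mem_cons.1 hzm with h | h
    · rintro rfl; exact (hoff i hi).1 (h ▸ ht)
    · exact (hR z h).2 i hi
  have hzadj : G.Adj z (x 0) := by
    have e : t :: (R ++ [x 0]) = L ++ z :: [x 0] := by
      rw [← List.cons_append, hz]; simp
    rw [e] at hc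
    exact (List.isChain_append.1 hc).2.1.rel
  have hinj : ∀ j, j ≤ K + 1 → ∀ i < j, x i ≠ x j := by
    intro j
    induction j using Nat.strong_induction_on with
    | _ j ih =>
    intro hj i hij he
    obtain ⟨j, rfl⟩ : ∃ j', j = j' + 1 := ⟨j - 1, by omega⟩
    have hjadj : G.Adj (x i) (x j) := by rw [he]; exact (hadj j (by omega)).symm
    have hi1 : G.Adj (x i) (x (i + 1)) := hadj i (by omega)
    have hne1 : x (i + 1) ≠ x j := by
      intro h
      rcases Nat.lt_trichotomy (i + 1) j with h' | h' | h'
      · exact ih j (by omega) (by omega) (i + 1) h' h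
      · subst h'; exact hnb i (by omega) he
      · have : i = j := by omega
        subst this
        exact hjadj.ne rfl
    rcases Nat.eq_zero_or_pos i with rfl | hi
    · exact (hoff 0 (by omega)).2 (three_le_gdeg hzadj.symm hi1 hjadj (hzX _ (by omega))
        (hzX _ (by omega)) hne1)
    · obtain ⟨i, rfl⟩ : ∃ i', i = i' + 1 := ⟨i - 1, by omega⟩
      exact (hoff (i + 1) (by omega)).2 (three_le_gdeg (hadj i (by omega)).symm hi1 hjadj
        (hnb i (by omega)) (ih j (by omega) (by omega) i (by omega)) hne1)
  have hinj' : ∀ i ≤ K + 1, ∀ j ≤ K + 1, x i = x j → i = j := by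
    intro i hi j hj h
    rcases Nat.lt_trichotomy i j with h' | h' | h'
    · exact absurd h (hinj j hj i h')
    · exact h'
    · exact absurd h.symm (hinj i hi j h')
  let Y := (List.range (K + 1)).map (fun i => x (i + 1))
  have hYc : (x 0 :: Y).IsChain G.Adj := by
    have : x 0 :: Y = (List.range (K + 2)).map x := by
      rw [List.range_succ_eq_map]; simp [Y, Function.comp_def]
    rw [this, List.isChain_iff_getElem]
    intro i hi
    simp at hi ⊢
    exact hadj i (by omega)
  have hYn : (x 0 :: Y).Nodup := by
    have : x 0 :: Y = (List.range (K + 2)).map x := by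
      rw [List.range_succ_eq_map]; simp [Y, Function.comp_def]
    rw [this]
    refine List.Nodup.map_on ?_ List.nodup_range
    intro a ha b hb h
    simp at ha hb
    exact hinj' a (by omega) b (by omega) h
  have hYm : ∀ y ∈ x 0 :: Y, ∃ i ≤ K + 1, y = x i := by
    intro y hy
    rcases List.mem_cons.1 hy with rfl | hy
    · exact ⟨0, by omega, rfl⟩
    · obtain ⟨i, hi, rfl⟩ := List.mem_map.1 hy
      simp at hi
      exact ⟨i + 1, by omega, rfl⟩
  have hbr := branch hT hmax ht (R := R ++ (x 0 :: Y)) (by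
      rw [← List.cons_append]
      rw [← List.cons_append] at hc
      exact List.isChain_split.2 ⟨hc, hYc⟩) (by
      rw [List.nodup_append]
      refine ⟨(List.nodup_append.1 hn.of_cons).1, hYn, ?_⟩
      intro a ha b hb
      obtain ⟨i, hi, rfl⟩ := hYm b hb
      exact (hR a ha).2 i hi) (by
      intro r hr
      rcases List.mem_append.1 hr with hr | hr
      · exact (hR r hr).1
      · obtain ⟨i, hi, rfl⟩ := hYm r hr
        exact (hoff i hi).1)
  have hlow : K ≤ wt {w | w ∉ BB G ∧ ¬ G.Adj v w} (R ++ (x 0 :: Y)) := by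
    have h1 : wt {w | w ∉ BB G ∧ ¬ G.Adj v w} ((List.range K).map (fun i => x (i + 1))) = K := by
      rw [wt_eq_length]
      · simp
      · intro y hy
        obtain ⟨i, hi, rfl⟩ := List.mem_map.1 hy
        simp at hi
        refine ⟨(hoff _ (by omega)).2, fun hva => (hoff (i + 1) (by omega)).2 ?_⟩
        refine three_le_gdeg (hadj i (by omega)).symm (hadj (i + 1) (by omega)) hva.symm
          (hnb i (by omega)) ?_ ?_
        · rintro h; exact (hoff i (by omega)).2 (h ▸ hv)
        · rintro h; exact (hoff (i + 2) (by omega)).2 (h ▸ hv)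
    conv_lhs => rw [← h1]
    apply wt_mono
    · refine List.Nodup.map_on ?_ List.nodup_range
      intro a ha b hb h
      simp at ha hb
      have := hinj' (a + 1) (by omega) (b + 1) (by omega) h
      omega
    · intro y hy
      obtain ⟨i, hi, rfl⟩ := List.mem_map.1 hy
      simp at hi
      simp only [List.mem_append, List.mem_cons, Y, List.mem_map, List.mem_range]
      exact Or.inr (Or.inr ⟨i, by omega, rfl⟩)
  omega

theorem init_DD {V : Type*} [Finite V] {G : SimpleGraph V} (hG : G.Connected) {v : V}
    (hv : v ∈ BB G) {T : List V} (hT : IsP G T)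
    (hmax : ∀ T', IsP G T' → wt {w | w ∉ BB G ∧ ¬ G.Adj v w} T' ≤ wt {w | w ∉ BB G ∧ ¬ G.Adj v w} T)
    {K : ℕ} (hK : {w | w ∉ BB G ∧ ¬ G.Adj v w}.ncard / 3 + 2 = K) : DD G T (K + 1) := by
  intro x hadj hnb
  by_contra hcon
  push Not at hcon
  obtain ⟨t, y, R, ht, ⟨i, hi, rfl⟩, hc, hn, hR⟩ := connector hG (A := {x | x ∈ T})
    (X := {y | ∃ i ≤ K + 1, y = x i})
    (List.exists_mem_of_ne_nil _ hT.ne) ⟨x 0, 0, by omega, rfl⟩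
    (by rintro a ha ⟨i, hi, rfl⟩; exact (hcon i hi).1 ha)
  have hR' : ∀ r ∈ R, r ∉ T ∧ ∀ i ≤ K + 1, r ≠ x i := by
    intro r hr
    refine ⟨(hR r hr).1, fun i hi h => (hR r hr).2 ⟨i, hi, h⟩⟩
  obtain ⟨L, z, hz⟩ : ∃ L z, t :: R = L ++ [z] :=
    ⟨_, _, (List.dropLast_append_getLast (l := t :: R) (by simp)).symm⟩
  have hzm : z ∈ t :: R := by rw [hz]; simp
  have hzX : ∀ i ≤ K + 1, z ≠ x i := by
    intro i hi
    rcases List.mem_cons.1 hzm with h | h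
    · rintro rfl; exact (hcon i hi).1 (h ▸ ht)
    · exact (hR' z h).2 i hi
  have hzadj : G.Adj z (x i) := by
    have e : t :: (R ++ [x i]) = L ++ z :: [x i] := by
      rw [← List.cons_append, hz]; simp
    rw [e] at hc
    exact (List.isChain_append.1 hc).2.1.rel
  rcases Nat.eq_zero_or_pos i with rfl | hi0
  · exact dd_core hv hT hmax hK x hadj hnb hcon ht hc hn hR'
  rcases Nat.lt_or_ge i (K + 1) with hlt | hge
  · obtain ⟨i, rfl⟩ : ∃ i', i = i' + 1 := ⟨i - 1, by omega⟩
    exact (hcon (i + 1) hi).2 (three_le_gdeg (hadj i (by omega)).symm (hadj (i + 1) hlt)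
      hzadj.symm (hnb i (by omega)) (hzX _ (by omega)).symm (hzX _ (by omega)).symm)
  · have : i = K + 1 := by omega
    subst this
    refine dd_core hv hT hmax hK (fun j => x (K + 1 - j)) ?_ ?_ ?_ ht (R := R) hc hn ?_
    · intro j hj
      have e : K + 1 - j = (K + 1 - (j + 1)) + 1 := by omega
      show G.Adj (x (K + 1 - j)) (x (K + 1 - (j + 1)))
      rw [e]
      exact (hadj _ (by omega)).symm
    · intro j hj
      have e : K + 1 - j = (K + 1 - (j + 2)) + 2 := by omega
      show x (K + 1 - j) ≠ x (K + 1 - (j + 2))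
      rw [e]
      exact (hnb _ (by omega)).symm
    · intro j hj; exact hcon _ (by omega)
    · intro r hr; exact ⟨(hR' r hr).1, fun j hj => (hR' r hr).2 _ (by omega)⟩

theorem init_QQ {V : Type*} [Finite V] {G : SimpleGraph V} (hG : G.Connected) {v : V}
    (hv : v ∈ BB G) : QQ G ({w | w ∉ BB G ∧ ¬ G.Adj v w}.ncard / 3 + 2) := by
  obtain ⟨T0, hT0, hmax0⟩ := exists_maximizer (fun T => IsP G T)
    (wt {w | w ∉ BB G ∧ ¬ G.Adj v w}) _ (fun T hT => wt_le_ncard _ hT.nodup)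
    ⟨[v], by simp, by simp, by simp⟩
  obtain ⟨T, hT, hsub, hS⟩ := exists_sat hT0
  have hmax : ∀ T', IsP G T' → wt {w | w ∉ BB G ∧ ¬ G.Adj v w} T' ≤
      wt {w | w ∉ BB G ∧ ¬ G.Adj v w} T := fun T' h =>
    (hmax0 T' h).trans (wt_mono _ hT0.nodup hsub)
  exact ⟨hG, T, hT, hS, init_CC hG hv hT hS hmax, init_DD hG hv hT hmax rfl⟩

theorem exists_v {V : Type*} [Finite V] {G : SimpleGraph V} (hG : G.Connected)
    (hnt : ¬ Traceable G) : ∃ v ∈ BB G, {w | w ∉ BB G ∧ ¬ G.Adj v w}.ncard =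
      Nat.card V - deltaPrime G - dStarStar G := by
  have hne : Nonempty V := hG.nonempty
  have hbd : BddAbove (Set.range (gdeg G)) := (Set.toFinite _).bddAbove
  obtain ⟨v0, hv0⟩ : deltaPrime G ∈ Set.range (gdeg G) :=
    Nat.sSup_mem (Set.range_nonempty _) hbd
  have hmem : dStarStar G ∈ {m | ∃ v, gdeg G v = deltaPrime G ∧
      m = ({w | 3 ≤ gdeg G w} \ G.neighborSet v).ncard} := by
    refine Nat.sSup_mem ⟨_, v0, hv0, rfl⟩ ⟨Nat.card V, ?_⟩
    rintro m ⟨v, -, rfl⟩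
    exact Set.ncard_le_card _
  obtain ⟨v, hv, hd⟩ := hmem
  have hvB : v ∈ BB G := by
    obtain ⟨T, hT, -, hS⟩ := exists_sat (G := G) (T := [v]) ⟨by simp, by simp, by simp⟩
    obtain ⟨t, ht, z, htz, hz⟩ := exists_exit hG hnt hT
    have h3 : 3 ≤ gdeg G t := hS t ht z htz hz
    have h4 : gdeg G t ≤ deltaPrime G := le_csSup hbd ⟨t, rfl⟩
    show 3 ≤ gdeg G v
    omega
  refine ⟨v, hvB, ?_⟩
  have h1 : (G.neighborSet v)ᶜ = ({w | 3 ≤ gdeg G w} \ G.neighborSet v) ∪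
      {w | w ∉ BB G ∧ ¬ G.Adj v w} := by
    ext w
    have : w ∈ BB G ↔ 3 ≤ gdeg G w := Iff.rfl
    simp only [Set.mem_compl_iff, mem_neighborSet, Set.mem_union, Set.mem_sdiff, Set.mem_ofPred_eq,
      this]
    tauto
  have h2 : (G.neighborSet v).ncard + (G.neighborSet v)ᶜ.ncard = Nat.card V :=
    Set.ncard_add_ncard_compl _
  have h3 : Disjoint ({w | 3 ≤ gdeg G w} \ G.neighborSet v) {w | w ∉ BB G ∧ ¬ G.Adj v w} := by
    rw [Set.disjoint_left]
    rintro w ⟨hw, -⟩ ⟨hw', -⟩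
    exact hw' hw
  rw [h1, Set.ncard_union_eq h3] at h2
  have h4 : (G.neighborSet v).ncard = deltaPrime G := hv
  omega

theorem main_bound {V : Type} [Fintype V] (G : SimpleGraph V) (hG : G.Connected) :
    hp G ≤ (Fintype.card V - deltaPrime G - dStarStar G) / 3 + 3 := by
  by_cases hnt : Traceable G
  · have h : hp G ≤ 0 := Nat.sInf_le (show Traceable (iterLine ⟨V, G⟩ 0).2 from hnt)
    omega
  · obtain ⟨v, hv, hm⟩ := exists_v hG hnt
    have hQ := init_QQ hG hv
    rw [hm, Nat.card_eq_fintype_card] at hQ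
    obtain ⟨i, hi, h⟩ := iter_main _ V G hQ
    have h' : hp G ≤ i := Nat.sInf_le h
    omega

/-- `h_p(G) ≤ ⌊(n - Δ'(G) - d**₍≥3₎(G))/3⌋ + 3`. -/
theorem stmt15 {V : Type} [Fintype V] (G : SimpleGraph V) (hG : G.Connected) :
    hp G ≤ (Fintype.card V - deltaPrime G - dStarStar G) / 3 + 3 := by
  exact main_bound G hG
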